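/- arXiv:1510.00504 — 6 statements merged into one kernel-verified Lean document; each statement's English description precedes it below -/
import Mathlib

section
/- Let Σ ⊆ H be a nonempty union of subspaces (t•x ∈ Σ for all t ∈ ℝ, x ∈ Σ) and let f : H → ℝ∪{+∞} satisfy f(x) < +∞ for every x ∈ Σ. Let M : H → F be a continuous linear map satisfying the RIP on Σ−Σ with constant δ, where 0 ≤ δ < δ_Σ(f) and δ_Σ(f) is computed with the union-of-subspaces formula δ_Σ^{UoS}. Then for every x₀ ∈ Σ, x₀ is the unique minimizer of f subject to the measurement constraint: every x ∈ H with Mx = Mx₀ and x ≠ x₀ satisfies f(x) > f(x₀). -/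
open scoped RealInnerProductSpace Pointwise ENNReal
open Metric

variable {H : Type*} [NormedAddCommGroup H] [InnerProductSpace ℝ H]

noncomputable def atomicNorm (A : Set H) (x : H) : ℝ≥0∞ :=
  ⨅ t : {t : ℝ // 0 ≤ t ∧ x ∈ t • closure (convexHull ℝ A)}, ENNReal.ofReal (t : ℝ)

noncomputable def coneNorm (S : Set H) (x : H) : ℝ≥0∞ :=
  atomicNorm (S ∩ sphere (0 : H) 1) x

noncomputable def deltaUoS (S : Set H) (x z : H) : ℝ :=
  if coneNorm S (x + z) = ⊤ then 0
  else (-⟪x, z⟫) /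
    (‖x‖ * Real.sqrt ((coneNorm S (x + z)).toReal ^ 2 - ‖x‖ ^ 2 - 2 * ⟪x, z⟫))

noncomputable def deltaCone (S : Set H) (x z : H) : ℝ :=
  if coneNorm S (x + z) = ⊤ then 0
  else (-2 * ⟪x, z⟫) / ((coneNorm S (x + z)).toReal ^ 2 - 2 * ⟪x, z⟫)

def descentSet (S : Set H) (f : H → EReal) : Set H := {z : H | ∃ x ∈ S, f (x + z) ≤ f x}

noncomputable def deltaAdmUoS (S T : Set H) : EReal :=
  ⨅ z : {z : H // z ∈ T ∧ z ≠ 0}, ⨆ x : {x : H // x ∈ S ∧ x ≠ 0},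
    ((deltaUoS S (x : H) (z : H) : ℝ) : EReal)

noncomputable def deltaAdmCone (S T : Set H) : EReal :=
  ⨅ z : {z : H // z ∈ T ∧ z ≠ 0}, ⨆ x : {x : H // x ∈ S ∧ x ≠ 0},
    ((deltaCone S (x : H) (z : H) : ℝ) : EReal)

/-- A continuous affine inequality valid on `A` is inherited by `t • closure (convexHull ℝ A)`. -/
theorem inner_le_of_mem_smul_closure_convexHull {A : Set H} {t c : ℝ} {v y : H}
    (h : ∀ u ∈ A, ⟪v, t • u⟫ ≤ c) (hy : y ∈ t • closure (convexHull ℝ A)) : ⟪v, y⟫ ≤ c := by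
  obtain ⟨w, hw, rfl⟩ := Set.mem_smul_set.mp hy
  have hconv : Convex ℝ {u : H | ⟪v, t • u⟫ ≤ c} := by
    refine convex_halfSpace_le ⟨fun a b => ?_, fun r a => ?_⟩ c
    · simp only [smul_add, inner_add_right]
    · simp only [inner_smul_right, smul_eq_mul]
      ring
  have hclosed : IsClosed {u : H | ⟪v, t • u⟫ ≤ c} :=
    isClosed_le (by fun_prop) continuous_const
  exact closure_minimal (convexHull_min h hconv) hclosed hw

theorem exists_lt_of_coneNorm_lt {S : Set H} {y : H} {r : ℝ}
    (h : coneNorm S y < ENNReal.ofReal r) :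
    ∃ t, 0 ≤ t ∧ t < r ∧ y ∈ t • closure (convexHull ℝ (S ∩ sphere (0 : H) 1)) := by
  obtain ⟨⟨t, ht0, hty⟩, htr⟩ := iInf_lt_iff.mp h
  exact ⟨t, ht0, (ENNReal.ofReal_lt_ofReal_iff_of_nonneg ht0).mp htr, hty⟩

section RestrictedIsometry

variable {F : Type*} [NormedAddCommGroup F] [InnerProductSpace ℝ F] {S : Set H}
  {M : H →L[ℝ] F} {δ : ℝ} {x z : H}

theorem neg_inner_le_of_mem_smul_closure_convexHull [CompleteSpace H] [CompleteSpace F]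
    (hUoS : ∀ (t : ℝ), ∀ x ∈ S, t • x ∈ S)
    (hRIP : ∀ x ∈ S, ∀ y ∈ S,
      (1 - δ) * ‖x - y‖ ^ 2 ≤ ‖M (x - y)‖ ^ 2 ∧ ‖M (x - y)‖ ^ 2 ≤ (1 + δ) * ‖x - y‖ ^ 2)
    (hx : x ∈ S) (hz : M z = 0) {t : ℝ}
    (ht : x + z ∈ t • closure (convexHull ℝ (S ∩ sphere (0 : H) 1))) (a : ℝ) :
    2 * a * (-⟪x, z⟫) ≤ δ * (t ^ 2 - ‖x‖ ^ 2 - 2 * ⟪x, z⟫ + a ^ 2 * ‖x‖ ^ 2) := by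
  have key : ∀ u ∈ S ∩ sphere (0 : H) 1,
      ⟪(4 * δ - 4 * a) • x + (4 * a) • M.adjoint (M x), t • u⟫ ≤ 2 * δ * t ^ 2
        - ((1 - δ) * (1 + a) ^ 2 - (1 + δ) * (1 - a) ^ 2) * ‖x‖ ^ 2
        + 4 * a * ‖M x‖ ^ 2 := by
    rintro u ⟨huS, hu⟩
    have hlower := (hRIP _ (hUoS t u huS) _ (hUoS (1 + a) x hx)).1
    have hupper := (hRIP _ (hUoS t u huS) _ (hUoS (1 - a) x hx)).2
    have hnorm : ‖t • u‖ ^ 2 = t ^ 2 := by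
      rw [norm_smul, mem_sphere_zero_iff_norm.mp hu, mul_one, Real.norm_eq_abs, sq_abs]
    rw [map_sub, map_smul M (1 + a), norm_sub_sq_real, norm_sub_sq_real, hnorm] at hlower
    rw [map_sub, map_smul M (1 - a), norm_sub_sq_real, norm_sub_sq_real, hnorm] at hupper
    simp only [inner_smul_right _ x, inner_smul_right _ (M x), norm_smul, mul_pow,
      Real.norm_eq_abs, sq_abs] at hlower hupper
    rw [inner_add_left, real_inner_smul_left, real_inner_smul_left,
      ContinuousLinearMap.adjoint_inner_left, real_inner_comm (t • u) x,
      real_inner_comm (M (t • u)) (M x)]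
    linarith
  have hxz := inner_le_of_mem_smul_closure_convexHull key ht
  rw [inner_add_left, real_inner_smul_left, real_inner_smul_left,
    ContinuousLinearMap.adjoint_inner_left, map_add, hz, add_zero, inner_add_right,
    real_inner_self_eq_norm_sq, real_inner_self_eq_norm_sq] at hxz
  linarith

theorem deltaUoS_le_of_map_eq_zero [CompleteSpace H] [CompleteSpace F]
    (hUoS : ∀ (t : ℝ), ∀ x ∈ S, t • x ∈ S) (hδ0 : 0 ≤ δ)
    (hRIP : ∀ x ∈ S, ∀ y ∈ S,
      (1 - δ) * ‖x - y‖ ^ 2 ≤ ‖M (x - y)‖ ^ 2 ∧ ‖M (x - y)‖ ^ 2 ≤ (1 + δ) * ‖x - y‖ ^ 2)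
    (hx : x ∈ S) (hx0 : x ≠ 0) (hz : M z = 0) : deltaUoS S x z ≤ δ := by
  unfold deltaUoS
  split_ifs with htop
  · exact hδ0
  set N := (coneNorm S (x + z)).toReal
  set Q := N ^ 2 - ‖x‖ ^ 2 - 2 * ⟪x, z⟫ with hQ
  rcases le_or_gt Q 0 with hQ0 | hQ0
  · rw [Real.sqrt_eq_zero_of_nonpos hQ0]
    simpa using hδ0
  have hxpos : 0 < ‖x‖ := norm_pos_iff.mpr hx0
  have hsq : √Q ^ 2 = Q := Real.sq_sqrt hQ0.le
  set a := √Q / ‖x‖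
  have hax : a * ‖x‖ = √Q := div_mul_cancel₀ _ hxpos.ne'
  have hbound : ∀ r ∈ Set.Ioi N, 2 * a * (-⟪x, z⟫) ≤
      δ * (r ^ 2 - ‖x‖ ^ 2 - 2 * ⟪x, z⟫ + a ^ 2 * ‖x‖ ^ 2) := by
    intro r hr
    obtain ⟨t, ht0, htr, ht⟩ := exists_lt_of_coneNorm_lt
      ((ENNReal.lt_ofReal_iff_toReal_lt htop).mpr hr)
    refine (neg_inner_le_of_mem_smul_closure_convexHull hUoS hRIP hx hz ht a).trans ?_
    gcongr
  have hlim : 2 * a * (-⟪x, z⟫) ≤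
      δ * (N ^ 2 - ‖x‖ ^ 2 - 2 * ⟪x, z⟫ + a ^ 2 * ‖x‖ ^ 2) := by
    have hcont : Continuous fun r : ℝ =>
        δ * (r ^ 2 - ‖x‖ ^ 2 - 2 * ⟪x, z⟫ + a ^ 2 * ‖x‖ ^ 2) := by fun_prop
    exact ge_of_tendsto (hcont.continuousWithinAt (s := Set.Ioi N) (x := N))
      (Filter.eventually_of_mem self_mem_nhdsWithin hbound)
  rw [← hQ, ← mul_pow, hax, hsq] at hlim
  rw [div_le_iff₀ (by positivity)]
  have ha0 : 0 < a := by positivity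
  refine le_of_mul_le_mul_left ?_ ha0
  have hprod : a * (δ * (‖x‖ * √Q)) = δ * Q := by
    linear_combination δ * √Q * hax + δ * hsq
  linarith

end RestrictedIsometry

theorem stmt0 {F : Type*} [NormedAddCommGroup F] [InnerProductSpace ℝ F]
    [CompleteSpace H] [CompleteSpace F]
    (S : Set H) (hne : S.Nonempty)
    (hUoS : ∀ (t : ℝ), ∀ x ∈ S, t • x ∈ S)
    (f : H → EReal) (hf : ∀ x ∈ S, f x < ⊤)
    (M : H →L[ℝ] F) (δ : ℝ) (hδ0 : 0 ≤ δ)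
    (hRIP : ∀ x ∈ S, ∀ y ∈ S,
      (1 - δ) * ‖x - y‖ ^ 2 ≤ ‖M (x - y)‖ ^ 2 ∧ ‖M (x - y)‖ ^ 2 ≤ (1 + δ) * ‖x - y‖ ^ 2)
    (hδ : (δ : EReal) < deltaAdmUoS S (descentSet S f)) :
    ∀ x₀ ∈ S, ∀ x : H, M x = M x₀ → x ≠ x₀ → f x₀ < f x := by
  intro x₀ hx₀ x hM hne'
  by_contra! hle
  have hz : x - x₀ ∈ descentSet S f := ⟨x₀, hx₀, by rwa [add_sub_cancel]⟩
  obtain ⟨⟨y, hyS, hy0⟩, hy⟩ := lt_iSup_iff.mp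
    (hδ.trans_le (iInf_le _ ⟨x - x₀, hz, sub_ne_zero.mpr hne'⟩))
  refine (EReal.coe_lt_coe_iff.mp hy).not_ge
    (deltaUoS_le_of_map_eq_zero hUoS hδ0 hRIP hyS hy0 ?_)
  rw [map_sub, hM, sub_self]
end

section
/- Let Σ ⊆ H be a nonempty cone (t•x ∈ Σ for all t ≥ 0, x ∈ Σ) and let f : H → ℝ∪{+∞} satisfy f(x) < +∞ for every x ∈ Σ. Let M : H → F be a continuous linear map satisfying the RIP on Σ−Σ with constant δ, where 0 ≤ δ < δ_Σ(f) and δ_Σ(f) is computed with the cone formula δ_Σ^{cone}. Then for every x₀ ∈ Σ, x₀ is the unique minimizer of f subject to the measurement constraint: every x ∈ H with Mx = Mx₀ and x ≠ x₀ satisfies f(x) > f(x₀). -/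
open scoped RealInnerProductSpace Pointwise ENNReal
open Metric

variable {H : Type*} [NormedAddCommGroup H] [InnerProductSpace ℝ H]

theorem le_toReal_atomicNorm {A : Set H} {y : H} {r : ℝ} (hfin : atomicNorm A y ≠ ⊤)
    (h : ∀ t : ℝ, 0 ≤ t → y ∈ t • closure (convexHull ℝ A) → r ≤ t) :
    r ≤ (atomicNorm A y).toReal := by
  rw [← ENNReal.ofReal_le_iff_le_toReal hfin]
  exact le_iInf fun t => ENNReal.ofReal_le_ofReal (h t t.2.1 t.2.2)

/-- A continuous linear functional bounded above on `A` is bounded above by the same constant on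
the closed convex hull of `A`. -/
theorem le_of_mem_closure_convexHull {A : Set H} (L : H →L[ℝ] ℝ) {C : ℝ} (hA : ∀ a ∈ A, L a ≤ C)
    {w : H} (hw : w ∈ closure (convexHull ℝ A)) : L w ≤ C :=
  closure_minimal (convexHull_min hA (convex_halfSpace_le L.isLinear C))
    (isClosed_le L.continuous continuous_const) hw

theorem norm_le_of_mem_smul_closure_convexHull {A : Set H} (hA : A ⊆ sphere (0 : H) 1) {t : ℝ}
    (ht : 0 ≤ t) {y : H} (hy : y ∈ t • closure (convexHull ℝ A)) : ‖y‖ ≤ t := by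
  obtain ⟨w, hw, rfl⟩ := hy
  have hball : w ∈ closedBall (0 : H) 1 :=
    closure_minimal (convexHull_min (hA.trans sphere_subset_closedBall) (convex_closedBall 0 1))
      isClosed_closedBall hw
  rw [mem_closedBall_zero_iff] at hball
  simpa [norm_smul, abs_of_nonneg ht] using mul_le_mul_of_nonneg_left hball ht

theorem norm_le_toReal_coneNorm {S : Set H} {y : H} (hfin : coneNorm S y ≠ ⊤) :
    ‖y‖ ≤ (coneNorm S y).toReal :=
  le_toReal_atomicNorm hfin fun _ ht hy =>
    norm_le_of_mem_smul_closure_convexHull Set.inter_subset_right ht hy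

/-- The restricted isometry property on secants bounds the correlation of a kernel vector `z` with
a point `x` of the cone, for every dilation factor `t` admissible for `x + z`. -/
theorem neg_two_mul_inner_le_of_rip {F : Type*} [NormedAddCommGroup F] [InnerProductSpace ℝ F]
    {S : Set H} (hcone : ∀ t : ℝ, 0 ≤ t → ∀ x ∈ S, t • x ∈ S) {M : H →L[ℝ] F} {δ : ℝ}
    (hRIP : ∀ x ∈ S, ∀ y ∈ S,
      (1 - δ) * ‖x - y‖ ^ 2 ≤ ‖M (x - y)‖ ^ 2 ∧ ‖M (x - y)‖ ^ 2 ≤ (1 + δ) * ‖x - y‖ ^ 2)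
    {x z : H} (hx : x ∈ S) (hz : M z = 0) {t : ℝ} (ht : 0 ≤ t)
    (hy : x + z ∈ t • closure (convexHull ℝ (S ∩ sphere (0 : H) 1))) :
    -2 * ⟪x, z⟫ ≤ δ * (t ^ 2 - 2 * ⟪x, z⟫) := by
  obtain ⟨w, hw, hwy⟩ := hy
  simp only at hwy
  have h0 : (0 : H) ∈ S := by simpa using hcone 0 le_rfl x hx
  let L : H →L[ℝ] ℝ := t • ((innerSL ℝ (M x)).comp M - (1 - δ) • innerSL ℝ x)
  have hL : ∀ v, L v = t * (⟪M x, M v⟫ - (1 - δ) * ⟪x, v⟫) := fun v => by simp [L]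
  have key : L w ≤ ‖M x‖ ^ 2 - (1 - δ) * ‖x‖ ^ 2 + δ * t ^ 2 / 2 := by
    refine le_of_mem_closure_convexHull L (fun a ha => ?_) hw
    have hnorm : ‖a‖ = 1 := by simpa using ha.2
    have hlow := (hRIP x hx ((t / 2) • a) (hcone _ (by positivity) a ha.1)).1
    have hupp := (hRIP a ha.1 0 h0).2
    rw [map_sub, map_smul, norm_sub_sq_real, norm_sub_sq_real, inner_smul_right, inner_smul_right,
      norm_smul, norm_smul, mul_pow, mul_pow, hnorm, Real.norm_eq_abs, sq_abs] at hlow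
    rw [sub_zero, hnorm] at hupp
    rw [hL]
    nlinarith [mul_le_mul_of_nonneg_left hupp (sq_nonneg (t / 2))]
  have hMw : t * ⟪M x, M w⟫ = ‖M x‖ ^ 2 := by
    rw [← inner_smul_right, ← map_smul, hwy, map_add, hz, add_zero, real_inner_self_eq_norm_sq]
  have hxw : t * ⟪x, w⟫ = ‖x‖ ^ 2 + ⟪x, z⟫ := by
    rw [← inner_smul_right, hwy, inner_add_right, real_inner_self_eq_norm_sq]
  rw [hL] at key
  linear_combination 2 * key - 2 * hMw + 2 * (1 - δ) * hxw

theorem deltaCone_le_of_rip {F : Type*} [NormedAddCommGroup F] [InnerProductSpace ℝ F]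
    {S : Set H} (hcone : ∀ t : ℝ, 0 ≤ t → ∀ x ∈ S, t • x ∈ S) {M : H →L[ℝ] F} {δ : ℝ}
    (hδ : 0 ≤ δ)
    (hRIP : ∀ x ∈ S, ∀ y ∈ S,
      (1 - δ) * ‖x - y‖ ^ 2 ≤ ‖M (x - y)‖ ^ 2 ∧ ‖M (x - y)‖ ^ 2 ≤ (1 + δ) * ‖x - y‖ ^ 2)
    {x z : H} (hx : x ∈ S) (hz : M z = 0) : deltaCone S x z ≤ δ := by
  unfold deltaCone
  split_ifs with hfin
  · exact hδ
  have hden : 0 ≤ (coneNorm S (x + z)).toReal ^ 2 - 2 * ⟪x, z⟫ := by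
    have hsq := pow_le_pow_left₀ (norm_nonneg _) (norm_le_toReal_coneNorm hfin) 2
    rw [norm_add_sq_real] at hsq
    nlinarith [sq_nonneg ‖x‖, sq_nonneg ‖z‖]
  refine div_le_of_le_mul₀ hden hδ ?_
  rcases hδ.eq_or_lt with rfl | hpos
  · obtain ⟨⟨t, ht, hy⟩, -⟩ := iInf_lt_iff.1 (lt_top_iff_ne_top.2 hfin)
    simpa using neg_two_mul_inner_le_of_rip hcone hRIP hx hz ht hy
  have hsqrt : √(-2 * ⟪x, z⟫ / δ + 2 * ⟪x, z⟫) ≤ (coneNorm S (x + z)).toReal := by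
    refine le_toReal_atomicNorm hfin fun t ht hy => Real.sqrt_le_iff.2 ⟨ht, ?_⟩
    rw [← le_sub_iff_add_le, div_le_iff₀' hpos]
    exact neg_two_mul_inner_le_of_rip hcone hRIP hx hz ht hy
  rw [← div_le_iff₀' hpos, le_sub_iff_add_le]
  exact (Real.sqrt_le_iff.1 hsqrt).2

theorem stmt1 {F : Type*} [NormedAddCommGroup F] [InnerProductSpace ℝ F]
    [CompleteSpace H] [CompleteSpace F]
    (S : Set H) (hne : S.Nonempty)
    (hcone : ∀ t : ℝ, 0 ≤ t → ∀ x ∈ S, t • x ∈ S)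
    (f : H → EReal) (hf : ∀ x ∈ S, f x < ⊤)
    (M : H →L[ℝ] F) (δ : ℝ) (hδ0 : 0 ≤ δ)
    (hRIP : ∀ x ∈ S, ∀ y ∈ S,
      (1 - δ) * ‖x - y‖ ^ 2 ≤ ‖M (x - y)‖ ^ 2 ∧ ‖M (x - y)‖ ^ 2 ≤ (1 + δ) * ‖x - y‖ ^ 2)
    (hδ : (δ : EReal) < deltaAdmCone S (descentSet S f)) :
    ∀ x₀ ∈ S, ∀ x : H, M x = M x₀ → x ≠ x₀ → f x₀ < f x := by
  intro x₀ hx₀ x hMx hne'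
  by_contra! hle
  have hmem : x - x₀ ∈ descentSet S f := ⟨x₀, hx₀, by simpa using hle⟩
  obtain ⟨⟨v, hv, _⟩, hlt⟩ :=
    lt_iSup_iff.1 (hδ.trans_le (iInf_le _ ⟨x - x₀, hmem, sub_ne_zero.2 hne'⟩))
  exact (EReal.coe_lt_coe_iff.1 hlt).not_ge
    (deltaCone_le_of_rip hcone hδ0 hRIP hv (by rw [map_sub, hMx, sub_self]))
end

section
/- Let Σ ⊆ H be a nonempty cone and let f : H → ℝ be continuous and coercive (f(x) → +∞ as ‖x‖ → +∞). Let t > f(0) be a real number such that the level set L(f,t) := {y ∈ H : f(y) ≤ t} is convex, and set A := L(f,t) ∩ Σ. Then T_{‖·‖_A}(Σ) ⊆ ℝ₊*·T_f(Σ): for every z ∈ H such that ‖x+z‖_A ≤ ‖x‖_A for some x ∈ Σ, there exist λ > 0 and x' ∈ Σ with f(x' + λ·z) ≤ f(x'). -/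
open scoped Pointwise ENNReal
open Metric

variable {H : Type*} [NormedAddCommGroup H] [InnerProductSpace ℝ H]

theorem atomicNorm_le_of_smul_mem {A : Set H} {c : ℝ} (hc : 0 < c) {x : H}
    (hx : c⁻¹ • x ∈ A) : atomicNorm A x ≤ ENNReal.ofReal c := by
  have hmem : x ∈ c • closure (convexHull ℝ A) :=
    (Set.mem_smul_set_iff_inv_smul_mem₀ hc.ne' _ _).2
      (subset_closure (subset_convexHull ℝ A hx))
  exact iInf_le (fun t : {t : ℝ // 0 ≤ t ∧ x ∈ t • closure (convexHull ℝ A)} =>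
    ENNReal.ofReal (t : ℝ)) ⟨c, hc.le, hmem⟩

theorem inv_smul_mem_of_atomicNorm_le {A L : Set H} (hL : IsClosed L) (hconv : Convex ℝ L)
    (h0 : (0 : H) ∈ L) (hA : A ⊆ L) {c : ℝ} (hc : 0 < c) {y : H}
    (hy : atomicNorm A y ≤ ENNReal.ofReal c) : c⁻¹ • y ∈ L := by
  have hclosure : closure (convexHull ℝ A) ⊆ L :=
    closure_minimal (convexHull_min hA hconv) hL
  have hlarger : ∀ d : ℝ, c < d → d⁻¹ • y ∈ L := by
    intro d hd
    have hd0 : 0 < d := hc.trans hd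
    have hlt : atomicNorm A y < ENNReal.ofReal d :=
      hy.trans_lt ((ENNReal.ofReal_lt_ofReal_iff hd0).2 hd)
    obtain ⟨⟨u, hu, w, hw, rfl⟩, hud⟩ := iInf_lt_iff.1 hlt
    have hud' : u < d := (ENNReal.ofReal_lt_ofReal_iff hd0).1 hud
    have hle : d⁻¹ * u ≤ 1 := by
      rw [inv_mul_le_iff₀ hd0]
      linarith
    simpa [smul_smul] using
      hconv.smul_mem_of_zero_mem h0 (hclosure hw) ⟨by positivity, hle⟩
  have hlim : Filter.Tendsto (fun d : ℝ => d⁻¹ • y) (nhdsWithin c (Set.Ioi c))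
      (nhds (c⁻¹ • y)) :=
    ((tendsto_inv₀ hc.ne').smul_const y).mono_left nhdsWithin_le_nhds
  exact hL.mem_of_tendsto hlim (by filter_upwards [self_mem_nhdsWithin] with d hd using hlarger d hd)

theorem exists_pos_lt_apply_smul {f : H → ℝ}
    (hcoer : ∀ c : ℝ, ∃ R : ℝ, ∀ x : H, R ≤ ‖x‖ → c ≤ f x) (t : ℝ) {x : H} (hx : x ≠ 0) :
    ∃ s : ℝ, 0 < s ∧ t < f (s • x) := by
  obtain ⟨R, hR⟩ := hcoer (t + 1)
  have hx' : 0 < ‖x‖ := norm_pos_iff.2 hx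
  have hpos : 0 < (|R| + 1) / ‖x‖ := by positivity
  refine ⟨(|R| + 1) / ‖x‖, hpos, ?_⟩
  have hnorm : ‖((|R| + 1) / ‖x‖) • x‖ = |R| + 1 := by
    rw [norm_smul, Real.norm_of_nonneg hpos.le, div_mul_cancel₀ _ hx'.ne']
  have := hR _ (by rw [hnorm]; linarith [le_abs_self R])
  linarith

theorem stmt5 [CompleteSpace H]
    (S : Set H) (hne : S.Nonempty) (hcone : ∀ t : ℝ, 0 ≤ t → ∀ x ∈ S, t • x ∈ S)
    (f : H → ℝ) (hf : Continuous f)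
    (hcoer : ∀ c : ℝ, ∃ R : ℝ, ∀ x : H, R ≤ ‖x‖ → c ≤ f x)
    (t : ℝ) (ht : f 0 < t) (hconv : Convex ℝ {y : H | f y ≤ t})
    (z : H)
    (hz : ∃ x ∈ S, atomicNorm ({y : H | f y ≤ t} ∩ S) (x + z) ≤
          atomicNorm ({y : H | f y ≤ t} ∩ S) x) :
    ∃ l : ℝ, 0 < l ∧ ∃ x' ∈ S, f (x' + l • z) ≤ f x' := by
  have hclosed : IsClosed {y : H | f y ≤ t} := isClosed_le hf continuous_const
  have hmem : ∀ {c : ℝ}, 0 < c → ∀ {y : H},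
      atomicNorm ({y : H | f y ≤ t} ∩ S) y ≤ ENNReal.ofReal c → f (c⁻¹ • y) ≤ t :=
    fun hc _ hy =>
      inv_smul_mem_of_atomicNorm_le hclosed hconv ht.le Set.inter_subset_left hc hy
  obtain ⟨x, hxS, hxz⟩ := hz
  rcases eq_or_ne x 0 with rfl | hx
  · have hz0 : z = 0 := by
      by_contra hz
      obtain ⟨s, hs, hst⟩ := exists_pos_lt_apply_smul hcoer t hz
      have hzero : atomicNorm ({y : H | f y ≤ t} ∩ S) (0 : H) ≤ ENNReal.ofReal s⁻¹ :=
        atomicNorm_le_of_smul_mem (inv_pos.2 hs) (by simpa using ⟨ht.le, hxS⟩)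
      have hle := hmem (inv_pos.2 hs) (hxz.trans hzero)
      rw [inv_inv, zero_add] at hle
      exact hle.not_gt hst
    exact ⟨1, one_pos, 0, hxS, by simp [hz0]⟩
  · obtain ⟨r, hr, hrt⟩ := exists_pos_lt_apply_smul hcoer t hx
    have hcont : ContinuousOn (fun s : ℝ => f (s • x)) (Set.Icc 0 r) := by fun_prop
    obtain ⟨s, hs, hst⟩ := intermediate_value_Ioo hr.le hcont
      (show t ∈ Set.Ioo (f ((0 : ℝ) • x)) (f (r • x)) by simpa using ⟨ht, hrt⟩)
    have hsx : s • x ∈ S := hcone s hs.1.le x hxS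
    have hxs : atomicNorm ({y : H | f y ≤ t} ∩ S) x ≤ ENNReal.ofReal s⁻¹ :=
      atomicNorm_le_of_smul_mem (inv_pos.2 hs.1) (by rw [inv_inv]; exact ⟨hst.le, hsx⟩)
    refine ⟨s, hs.1, s • x, hsx, ?_⟩
    have hle := hmem (inv_pos.2 hs.1) (hxz.trans hxs)
    rw [inv_inv, smul_add] at hle
    exact hle.trans hst.ge
end

section
/- Let ε ≥ η ≥ 0 and let C_Σ ≥ 0 be a real constant. Assume the following stable recovery property: for every x₀ ∈ Σ and every e ∈ F, every minimizer x* of f over {x ∈ H : ‖Mx − (Mx₀+e)‖_F ≤ ε} satisfies ‖x*−x₀‖ ≤ C_Σ·(ε + ‖e‖_F). Then for every x₀ ∈ H and every e ∈ F with ‖e‖_F ≤ η, every minimizer x* of f over {x ∈ H : ‖Mx − (Mx₀+e)‖_F ≤ ε} satisfies ‖x*−x₀‖ ≤ C_Σ·(ε+η) + d_M(x₀,Σ), where d_M(x₀,Σ) := inf_{x̃ ∈ Σ} ( C_Σ·‖M(x₀−x̃)‖_F + ‖x₀−x̃‖ ). -/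
theorem stmt8 {H F : Type*} [NormedAddCommGroup H] [InnerProductSpace ℝ H] [CompleteSpace H]
    [NormedAddCommGroup F] [NormedSpace ℝ F]
    (S : Set H) (M : H →L[ℝ] F) (f : H → EReal)
    (ε η C : ℝ) (hη : 0 ≤ η) (hεη : η ≤ ε) (hC : 0 ≤ C)
    (hstable : ∀ x₀ ∈ S, ∀ e : F, ∀ xs : H, ‖M xs - (M x₀ + e)‖ ≤ ε →
      (∀ x : H, ‖M x - (M x₀ + e)‖ ≤ ε → f xs ≤ f x) →
      ‖xs - x₀‖ ≤ C * (ε + ‖e‖)) :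
    ∀ x₀ : H, ∀ e : F, ‖e‖ ≤ η → ∀ xs : H, ‖M xs - (M x₀ + e)‖ ≤ ε →
      (∀ x : H, ‖M x - (M x₀ + e)‖ ≤ ε → f xs ≤ f x) →
      ∀ xt ∈ S, ‖xs - x₀‖ ≤ C * (ε + η) + (C * ‖M (x₀ - xt)‖ + ‖x₀ - xt‖) := by
  intro x₀ e he xs hxs hmin xt hxt
  have hdata : M xt + (M (x₀ - xt) + e) = M x₀ + e := by
    rw [map_sub]; abel
  have hrec : ‖xs - xt‖ ≤ C * (ε + ‖M (x₀ - xt) + e‖) :=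
    hstable xt hxt (M (x₀ - xt) + e) xs (by rwa [hdata]) (by rwa [hdata])
  have hnoise : ‖M (x₀ - xt) + e‖ ≤ ‖M (x₀ - xt)‖ + η :=
    (norm_add_le _ _).trans (by gcongr)
  calc ‖xs - x₀‖ ≤ ‖xs - xt‖ + ‖xt - x₀‖ := norm_sub_le_norm_sub_add_norm_sub _ _ _
    _ = ‖xs - xt‖ + ‖x₀ - xt‖ := by rw [norm_sub_rev xt x₀]
    _ ≤ C * (ε + (‖M (x₀ - xt)‖ + η)) + ‖x₀ - xt‖ := by
      gcongr
      exact hrec.trans (by gcongr)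
    _ = C * (ε + η) + (C * ‖M (x₀ - xt)‖ + ‖x₀ - xt‖) := by ring
end

section
/- Let A ⊆ S(1) be a set of normalized atoms and let K ≥ 1. Let u = Σ_{i=1}^L c_i·a_i where L ≥ 1, c_1,…,c_L ∈ ℝ and a_1,…,a_L ∈ A are pairwise orthogonal. Let Σ ⊆ H be any set that contains every vector of the form Σ_{i=1}^m d_i·b_i with m ≤ K, d_1,…,d_m ∈ ℝ, and b_1,…,b_m ∈ A pairwise orthogonal. Then ‖u‖_Σ ≤ max( (Σ_{i=1}^L |c_i|)/sqrt(K), sqrt(K)·max_{1≤i≤L} |c_i| ). -/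
open scoped RealInnerProductSpace Pointwise ENNReal
open Metric

variable {H : Type*} [NormedAddCommGroup H] [InnerProductSpace ℝ H]

theorem Finset.exists_card_eq_forall_notMem_le {ι : Type*} [Fintype ι] (p : ι → ℝ) (k : ℕ)
    (hk : k ≤ Fintype.card ι) :
    ∃ T : Finset ι, T.card = k ∧ ∀ i ∈ T, ∀ j ∉ T, p j ≤ p i := by
  classical
  induction k with
  | zero => exact ⟨∅, by simp⟩
  | succ k ih =>
    obtain ⟨T, hT, hle⟩ := ih (by omega)
    have hne : (Tᶜ : Finset ι).Nonempty := by
      rw [← Finset.card_pos, Finset.card_compl]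
      omega
    obtain ⟨x, hx, hmax⟩ := Finset.exists_max_image Tᶜ p hne
    rw [Finset.mem_compl] at hx
    refine ⟨insert x T, by rw [Finset.card_insert_of_notMem hx, hT], fun i hi j hj => ?_⟩
    rw [Finset.mem_insert, not_or] at hj
    rcases Finset.mem_insert.1 hi with rfl | hi
    · exact hmax j (Finset.mem_compl.2 hj.2)
    · exact hle i hi j hj.2

/-- A linear form with nonnegative coefficients on the polytope cut out by the box `[0, r]^ι` and
`∑ c ≤ K r` is bounded by `r` times the sum of at most `K` of its coefficients. -/
theorem exists_finset_sum_mul_le {ι : Type*} [Fintype ι] [Nonempty ι] (c p : ι → ℝ) (K : ℕ)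
    (hK : 1 ≤ K) (r : ℝ) (hp : ∀ i, 0 ≤ p i) (hc : ∀ i, 0 ≤ c i) (hcr : ∀ i, c i ≤ r)
    (hsum : ∑ i, c i ≤ K * r) :
    ∃ T : Finset ι, T.Nonempty ∧ T.card ≤ K ∧ ∑ i, c i * p i ≤ r * ∑ i ∈ T, p i := by
  classical
  rcases le_total (Fintype.card ι) K with h | h
  · refine ⟨Finset.univ, Finset.univ_nonempty, h, ?_⟩
    rw [Finset.mul_sum]
    exact Finset.sum_le_sum fun i _ => mul_le_mul_of_nonneg_right (hcr i) (hp i)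
  · obtain ⟨T, hT, hle⟩ := Finset.exists_card_eq_forall_notMem_le p K h
    have hne : T.Nonempty := Finset.card_pos.1 (by omega)
    refine ⟨T, hne, hT.le, ?_⟩
    obtain ⟨x, hx, hmin⟩ := Finset.exists_min_image T p hne
    have h1 : ∑ i, c i * (p i - p x) ≤ ∑ i ∈ T, r * (p i - p x) := by
      rw [← Finset.sum_add_sum_compl T]
      have h2 : ∑ i ∈ Tᶜ, c i * (p i - p x) ≤ 0 := Finset.sum_nonpos fun j hj =>
        mul_nonpos_of_nonneg_of_nonpos (hc j)
          (sub_nonpos.2 (hle x hx j (Finset.mem_compl.1 hj)))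
      have h3 : ∑ i ∈ T, c i * (p i - p x) ≤ ∑ i ∈ T, r * (p i - p x) :=
        Finset.sum_le_sum fun i hi =>
          mul_le_mul_of_nonneg_right (hcr i) (sub_nonneg.2 (hmin i hi))
      linarith
    simp only [mul_sub, Finset.sum_sub_distrib, ← Finset.sum_mul, Finset.sum_const, hT,
      nsmul_eq_mul, ← Finset.mul_sum] at h1
    nlinarith [mul_le_mul_of_nonneg_right hsum (hp x)]

theorem norm_sum_smul_of_orthonormal {ι : Type*} {a : ι → H} (ha : Orthonormal ℝ a)
    (d : ι → ℝ) (T : Finset ι) : ‖∑ i ∈ T, d i • a i‖ ^ 2 = ∑ i ∈ T, d i ^ 2 := by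
  rw [← real_inner_self_eq_norm_sq, ha.inner_sum]
  exact Finset.sum_congr rfl fun i _ => by simp [sq]

theorem mem_of_sparse_sums {ι : Type*} {A S : Set H} {K : ℕ} {a : ι → H} (ha : ∀ i, a i ∈ A)
    (horth : ∀ i j, i ≠ j → ⟪a i, a j⟫ = 0)
    (hS : ∀ m : ℕ, m ≤ K → ∀ (d : Fin m → ℝ) (b : Fin m → H),
      (∀ i, b i ∈ A) → (∀ i j, i ≠ j → ⟪b i, b j⟫ = 0) → (∑ i, d i • b i) ∈ S)
    (d : ι → ℝ) (T : Finset ι) (hT : T.card ≤ K) : ∑ i ∈ T, d i • a i ∈ S := by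
  have h := hS T.card hT (fun k => d (T.equivFin.symm k)) (fun k => a (T.equivFin.symm k))
    (fun k => ha _) (fun k l hkl => horth _ _ fun h =>
      hkl (T.equivFin.symm.injective (Subtype.ext h)))
  rwa [Equiv.sum_comp T.equivFin.symm (fun x : T => d x • a x),
    Finset.sum_coe_sort T (fun x => d x • a x)] at h

theorem atomicNorm_le_of_mem_smul {A : Set H} {x : H} {t : ℝ} (ht : 0 ≤ t)
    (hx : x ∈ t • closure (convexHull ℝ A)) : atomicNorm A x ≤ ENNReal.ofReal t :=
  iInf_le (fun t : {t : ℝ // 0 ≤ t ∧ x ∈ t • closure (convexHull ℝ A)} =>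
    ENNReal.ofReal (t : ℝ)) ⟨t, ht, hx⟩

/-- The dual description of membership in a dilate of the closed convex hull. -/
theorem mem_smul_closure_convexHull {B : Set H} {x : H} {t : ℝ} (ht : 0 < t)
    (h : ∀ f : H →L[ℝ] ℝ, ∃ v ∈ B, f x ≤ t * f v) :
    x ∈ t • closure (convexHull ℝ B) := by
  rw [Set.mem_smul_set_iff_inv_smul_mem₀ ht.ne']
  by_contra hx
  obtain ⟨f, s, hlt, hs⟩ := geometric_hahn_banach_closed_point
    (convex_convexHull ℝ B).closure isClosed_closure hx
  obtain ⟨v, hv, hle⟩ := h f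
  have h1 := hlt v (subset_closure (subset_convexHull ℝ B hv))
  rw [map_smul, smul_eq_mul] at hs
  have h2 : t⁻¹ * f x ≤ f v := by
    rw [inv_mul_le_iff₀ ht]
    exact hle
  linarith

theorem stmt10 [CompleteSpace H]
    (A : Set H) (hA : A ⊆ sphere (0 : H) 1) (K : ℕ) (hK : 1 ≤ K)
    (L : ℕ) (hL : 1 ≤ L) (c : Fin L → ℝ) (a : Fin L → H)
    (ha : ∀ i, a i ∈ A) (horth : ∀ i j, i ≠ j → ⟪a i, a j⟫ = 0)
    (S : Set H)
    (hS : ∀ m : ℕ, m ≤ K → ∀ (d : Fin m → ℝ) (b : Fin m → H),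
      (∀ i, b i ∈ A) → (∀ i j, i ≠ j → ⟪b i, b j⟫ = 0) →
      (∑ i, d i • b i) ∈ S) :
    coneNorm S (∑ i, c i • a i) ≤
      ENNReal.ofReal (max ((∑ i, |c i|) / Real.sqrt K)
        (Real.sqrt K * ⨆ i, |c i|)) := by
  have : Nonempty (Fin L) := ⟨⟨0, hL⟩⟩
  have hK0 : (0 : ℝ) < √K := Real.sqrt_pos.2 (by exact_mod_cast hK)
  have hon : Orthonormal ℝ a :=
    ⟨fun i => by simpa using hA (ha i), fun i j hij => horth i j hij⟩
  have hbdd : ∀ i, |c i| ≤ ⨆ i, |c i| := le_ciSup (Set.finite_range fun i => |c i|).bddAbove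
  set M := max ((∑ i, |c i|) / √K) (√K * ⨆ i, |c i|) with hM
  have hM0 : 0 ≤ M := le_max_of_le_left (by positivity)
  have hcM : ∀ i, |c i| ≤ M / √K := fun i => by
    rw [le_div_iff₀ hK0, mul_comm]
    exact (mul_le_mul_of_nonneg_left (hbdd i) hK0.le).trans (le_max_right _ _)
  have hsum : ∑ i, |c i| ≤ K * (M / √K) := by
    have h := (div_le_iff₀ hK0).1 (le_max_left ((∑ i, |c i|) / √K) (√K * ⨆ i, |c i|))
    rw [← hM] at h
    rwa [mul_div_left_comm, Real.div_sqrt]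
  refine atomicNorm_le_of_mem_smul hM0 ?_
  rcases hM0.eq_or_lt with h0 | hpos
  · have hc : ∀ i, c i = 0 := fun i => by
      have := hcM i
      rw [← h0, zero_div] at this
      exact abs_nonpos_iff.1 this
    have haS : a ⟨0, hL⟩ ∈ S ∩ sphere (0 : H) 1 :=
      ⟨by simpa using mem_of_sparse_sums ha horth hS (fun _ => 1) {⟨0, hL⟩} (by simpa using hK),
        hA (ha _)⟩
    exact ⟨_, subset_closure (subset_convexHull ℝ _ haS), by simp [← h0, hc]⟩
  · refine mem_smul_closure_convexHull hpos fun f => ?_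
    obtain ⟨T, hne, hTK, hle⟩ := exists_finset_sum_mul_le (fun i => |c i|) (fun i => |f (a i)|) K
      hK (M / √K) (fun _ => abs_nonneg _) (fun _ => abs_nonneg _) hcM hsum
    have hT0 : (0 : ℝ) < T.card := by exact_mod_cast hne.card_pos
    have hsT : 0 < √(T.card : ℝ) := Real.sqrt_pos.2 hT0
    let e : Fin L → ℝ := fun i => if 0 ≤ f (a i) then 1 else -1
    have he : ∀ i, e i ^ 2 = 1 := fun i => by
      simp only [e]
      split_ifs <;> norm_num
    have hef : ∀ i, e i * f (a i) = |f (a i)| := fun i => by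
      simp only [e]
      split_ifs with h
      · rw [abs_of_nonneg h, one_mul]
      · rw [abs_of_neg (not_le.1 h), neg_one_mul]
    refine ⟨∑ i ∈ T, (e i / √T.card) • a i, ⟨mem_of_sparse_sums ha horth hS _ T hTK, ?_⟩, ?_⟩
    · rw [mem_sphere_zero_iff_norm, ← sq_eq_sq₀ (norm_nonneg _) zero_le_one,
        norm_sum_smul_of_orthonormal hon]
      simp [div_pow, he, Real.sq_sqrt hT0.le, hT0.ne']
    · have hfv : f (∑ i ∈ T, (e i / √T.card) • a i) = (∑ i ∈ T, |f (a i)|) / √T.card := by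
        rw [map_sum, Finset.sum_div]
        refine Finset.sum_congr rfl fun i _ => ?_
        rw [map_smul, smul_eq_mul, div_mul_eq_mul_div, hef]
      calc f (∑ i, c i • a i) = ∑ i, c i * f (a i) := by simp [map_sum]
        _ ≤ ∑ i, |c i| * |f (a i)| :=
          Finset.sum_le_sum fun i _ => (le_abs_self _).trans (abs_mul _ _).le
        _ ≤ M / √K * ∑ i ∈ T, |f (a i)| := hle
        _ = M * ((∑ i ∈ T, |f (a i)|) / √K) := by ring
        _ ≤ M * ((∑ i ∈ T, |f (a i)|) / √T.card) := by gcongr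
        _ = _ := by rw [hfv]
end

section
/- Assume 1 ≤ K ≤ |G|. Let z ≠ 0 be such that ‖x̃+z‖_A ≤ ‖x̃‖_A for some x̃ ∈ Σ_K (i.e., z ∈ T_{‖·‖_A}(Σ_K)\{0}), and let x be any minimizer over Σ_K of the function x ↦ ‖x+z‖_A − ‖x‖_A. Then x ≠ 0 and ‖x+z‖_{Σ_K} ≤ ‖x‖. -/
open scoped RealInnerProductSpace Pointwise ENNReal
open Metric

variable {H : Type*} [NormedAddCommGroup H] [InnerProductSpace ℝ H]

noncomputable def gproj (e : ℕ → H) (g : Finset ℕ) (x : H) : H :=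
  ∑ i ∈ g, ⟪x, e i⟫ • e i

noncomputable def gprojS (e : ℕ → H) (Hs : Finset (Finset ℕ)) (x : H) : H :=
  ∑ g ∈ Hs, gproj e g x

def Egrp (e : ℕ → H) (G : Finset (Finset ℕ)) : Set H :=
  (Submodule.span ℝ (e '' (G.biUnion id : Finset ℕ)) : Set H)

def SigmaK (e : ℕ → H) (G : Finset (Finset ℕ)) (K : ℕ) : Set H :=
  {x : H | ∃ H' ⊆ G, H'.card ≤ K ∧ x = gprojS e H' x}

noncomputable def groupNormR (e : ℕ → H) (G : Finset (Finset ℕ)) (x : H) : ℝ :=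
  ∑ g ∈ G, ‖gproj e g x‖

open Classical in
noncomputable def groupNorm (e : ℕ → H) (G : Finset (Finset ℕ)) (x : H) : ℝ≥0∞ :=
  if x ∈ Egrp e G then ENNReal.ofReal (groupNormR e G x) else ⊤

noncomputable def dualNorm (e : ℕ → H) (G : Finset (Finset ℕ)) (x : H) : ℝ :=
  sSup ((fun g => ‖gproj e g x‖) '' (G : Set (Finset ℕ)))

section Combinatorics

variable {ι : Type*} [DecidableEq ι]

theorem exists_powersetCard_forall_le (G : Finset ι) (b : ι → ℝ) {K : ℕ} (hK : K ≤ G.card) :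
    ∃ S ⊆ G, S.card = K ∧ ∀ s ∈ S, ∀ h ∈ G, h ∉ S → b h ≤ b s := by
  obtain ⟨S, hS, hmax⟩ := Finset.exists_max_image (G.powersetCard K) (fun S => ∑ i ∈ S, b i)
    (Finset.powersetCard_nonempty.2 hK)
  rw [Finset.mem_powersetCard] at hS
  refine ⟨S, hS.1, hS.2, fun s hs h hh hhS => ?_⟩
  have hh' : h ∉ S.erase s := fun hc => hhS (Finset.mem_of_mem_erase hc)
  have hcard : (insert h (S.erase s)).card = K := by
    rw [Finset.card_insert_of_notMem hh', Finset.card_erase_of_mem hs]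
    have := Finset.card_pos.2 ⟨s, hs⟩
    omega
  have := hmax (insert h (S.erase s)) (Finset.mem_powersetCard.2
    ⟨Finset.insert_subset hh ((Finset.erase_subset _ _).trans hS.1), hcard⟩)
  rw [Finset.sum_insert hh', ← Finset.add_sum_erase S b hs] at this
  linarith

theorem sum_mul_add_sum_sdiff_mul_le {G T : Finset ι} (hTG : T ⊆ G) (hT : T.Nonempty)
    {a b d : ι → ℝ} (ha : ∀ i, 0 ≤ a i) (hb : ∀ i, 0 ≤ b i) (hd : ∀ i, 0 ≤ d i)
    (hsep : ∀ g ∈ T, ∀ h ∈ G, h ∉ T → a h ≤ a g)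
    (hsum : ∑ i ∈ G \ T, a i ≤ ∑ i ∈ T, a i) {M : ℝ} (hM : 0 ≤ M)
    (hbM : ∀ S ⊆ G, S.card = T.card → ∑ i ∈ S, b i ^ 2 ≤ M ^ 2) :
    ∑ i ∈ T, d i * b i + ∑ i ∈ G \ T, a i * b i ≤ M * √(∑ i ∈ T, (d i + a i) ^ 2) := by
  obtain ⟨S, hSG, hScard, hStop⟩ := exists_powersetCard_forall_le G b (Finset.card_le_card hTG)
  have hSne : S.Nonempty := Finset.card_pos.1 (hScard ▸ Finset.card_pos.2 hT)
  obtain ⟨s₀, hs₀, hmin⟩ := Finset.exists_min_image S b hSne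
  obtain ⟨π, hπ⟩ := Finset.exists_equiv_extend_of_card_eq (α := T) (t := S)
    (by simp [hScard]) (s := Finset.univ.filter fun i : T => (i : ι) ∈ S) (f := Subtype.val)
    (by intro i; simp; tauto) (Subtype.val_injective.injOn)
  set τ := b s₀
  have hτ : 0 ≤ τ := hb _
  set A : ι → ℝ := fun i => if i ∈ T then 0 else a i with hA
  have hA0 : ∀ i, 0 ≤ A i := fun i => by simp only [hA]; split_ifs; exacts [le_rfl, ha i]
  have hAsum : ∀ c : ι → ℝ, ∑ i ∈ G \ T, a i * c i = ∑ i ∈ G, A i * c i := fun c => by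
    rw [← Finset.sum_sdiff hTG]
    have : ∑ i ∈ T, A i * c i = 0 := Finset.sum_eq_zero fun i hi => by simp [hA, hi]
    rw [this, add_zero]
    exact Finset.sum_congr rfl fun i hi => by simp [hA, (Finset.mem_sdiff.1 hi).2]
  have hS_le : ∑ i ∈ G, A i * (b i - τ) ≤ ∑ i ∈ S, A i * (b i - τ) := by
    rw [← Finset.sum_sdiff hSG]
    have : ∑ i ∈ G \ S, A i * (b i - τ) ≤ 0 := Finset.sum_nonpos fun i hi => by
      rw [Finset.mem_sdiff] at hi
      exact mul_nonpos_of_nonneg_of_nonpos (hA0 i) (sub_nonpos.2 (hStop s₀ hs₀ i hi.1 hi.2))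
    linarith
  have hreindex : ∀ f : ι → ℝ, ∑ i ∈ S, f i = ∑ i : T, f (π i) := fun f => by
    rw [← Finset.sum_coe_sort S f]
    exact (Equiv.sum_comp π fun j : S => f j).symm
  have hbπ : ∀ i : T, b i ≤ b (π i) := fun i => by
    by_cases hi : (i : ι) ∈ S
    · rw [hπ i (by simpa using hi)]
    · exact hStop _ (π i).2 _ (hTG i.2) hi
  have hAπ : ∀ i : T, A (π i) ≤ a i := fun i => by
    simp only [hA]
    split_ifs with h
    · exact ha _
    · exact hsep _ i.2 _ (hSG (π i).2) h
  have hone : ∑ i ∈ G, A i ≤ ∑ i : T, a i := by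
    have := hAsum 1
    simp only [Pi.one_apply, mul_one] at this
    rwa [← this, Finset.sum_coe_sort T a]
  have htail : ∑ i ∈ G \ T, a i * b i ≤ ∑ i : T, a i * b (π i) := by
    calc ∑ i ∈ G \ T, a i * b i = ∑ i ∈ G, A i * (b i - τ) + (∑ i ∈ G, A i) * τ := by
          rw [hAsum, Finset.sum_mul, ← Finset.sum_add_distrib]
          exact Finset.sum_congr rfl fun i _ => by ring
      _ ≤ ∑ i : T, a i * (b (π i) - τ) + (∑ i : T, a i) * τ := by
          refine add_le_add ((hS_le.trans_eq (hreindex _)).trans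
            (Finset.sum_le_sum fun i _ => ?_)) (mul_le_mul_of_nonneg_right hone hτ)
          exact mul_le_mul_of_nonneg_right (hAπ i) (sub_nonneg.2 (hmin _ (π i).2))
      _ = ∑ i : T, a i * b (π i) := by
          rw [Finset.sum_mul, ← Finset.sum_add_distrib]
          exact Finset.sum_congr rfl fun i _ => by ring
  have hhead : ∑ i ∈ T, d i * b i ≤ ∑ i : T, d i * b (π i) := by
    rw [← Finset.sum_coe_sort T fun i => d i * b i]
    exact Finset.sum_le_sum fun i _ => mul_le_mul_of_nonneg_left (hbπ i) (hd _)
  calc ∑ i ∈ T, d i * b i + ∑ i ∈ G \ T, a i * b i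
      ≤ ∑ i : T, b (π i) * (d i + a i) := by
        refine (add_le_add hhead htail).trans_eq ?_
        rw [← Finset.sum_add_distrib]
        exact Finset.sum_congr rfl fun i _ => by ring
    _ ≤ √(∑ i : T, b (π i) ^ 2) * √(∑ i : T, (d i + a i) ^ 2) :=
        Real.sum_mul_le_sqrt_mul_sqrt _ _ _
    _ ≤ M * √(∑ i ∈ T, (d i + a i) ^ 2) := by
        rw [← hreindex fun i => b i ^ 2, Finset.sum_coe_sort T fun i => (d i + a i) ^ 2]
        exact mul_le_mul_of_nonneg_right (Real.sqrt_le_iff.2 ⟨hM, hbM S hSG hScard⟩)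
          (Real.sqrt_nonneg _)

end Combinatorics

section GroupProjections

variable (e : ℕ → H)

theorem gproj_add (g : Finset ℕ) (x y : H) : gproj e g (x + y) = gproj e g x + gproj e g y := by
  simp [gproj, inner_add_left, add_smul, Finset.sum_add_distrib]

theorem gproj_smul (g : Finset ℕ) (c : ℝ) (x : H) : gproj e g (c • x) = c • gproj e g x := by
  simp [gproj, real_inner_smul_left, mul_smul, Finset.smul_sum]

theorem gproj_zero (g : Finset ℕ) : gproj e g (0 : H) = 0 := by simp [gproj]

theorem gproj_neg (g : Finset ℕ) (x : H) : gproj e g (-x) = -gproj e g x := by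
  simpa using gproj_smul e g (-1) x

theorem gproj_sum {ι : Type*} (g : Finset ℕ) (s : Finset ι) (f : ι → H) :
    gproj e g (∑ i ∈ s, f i) = ∑ i ∈ s, gproj e g (f i) := by
  classical
  induction s using Finset.induction_on with
  | empty => simp [gproj_zero]
  | insert i s hi ih => rw [Finset.sum_insert hi, Finset.sum_insert hi, gproj_add, ih]

theorem gprojS_add (S : Finset (Finset ℕ)) (x y : H) :
    gprojS e S (x + y) = gprojS e S x + gprojS e S y := by
  simp [gprojS, gproj_add, Finset.sum_add_distrib]

theorem gprojS_smul (S : Finset (Finset ℕ)) (c : ℝ) (x : H) :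
    gprojS e S (c • x) = c • gprojS e S x := by
  simp [gprojS, gproj_smul, Finset.smul_sum]

theorem smul_mem_SigmaK {G : Finset (Finset ℕ)} {K : ℕ} {x : H} (hx : x ∈ SigmaK e G K) (c : ℝ) :
    c • x ∈ SigmaK e G K := by
  obtain ⟨S, hSG, hSK, hxS⟩ := hx
  exact ⟨S, hSG, hSK, by rw [gprojS_smul, ← hxS]⟩

theorem gprojS_mem_Egrp {G S : Finset (Finset ℕ)} (hS : S ⊆ G) (x : H) :
    gprojS e S x ∈ Egrp e G := by
  refine Submodule.sum_mem _ fun g hg => Submodule.sum_mem _ fun i hi =>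
    Submodule.smul_mem _ _ (Submodule.subset_span ⟨i, ?_, rfl⟩)
  exact Finset.mem_coe.2 (Finset.mem_biUnion.2 ⟨g, hS hg, hi⟩)

variable {e}

theorem inner_gproj_basis (he : Orthonormal ℝ e) (g : Finset ℕ) (x : H) (i : ℕ) :
    ⟪gproj e g x, e i⟫ = if i ∈ g then ⟪x, e i⟫ else 0 := by
  simp [gproj, sum_inner, real_inner_smul_left, orthonormal_iff_ite.1 he]

theorem gproj_gproj_self (he : Orthonormal ℝ e) (g : Finset ℕ) (x : H) :
    gproj e g (gproj e g x) = gproj e g x := by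
  rw [gproj]
  conv_rhs => rw [gproj]
  exact Finset.sum_congr rfl fun i hi => by rw [inner_gproj_basis he, if_pos hi]

theorem gproj_gproj_of_disjoint (he : Orthonormal ℝ e) {g g' : Finset ℕ} (hgg : Disjoint g g')
    (x : H) : gproj e g (gproj e g' x) = 0 := by
  rw [gproj]
  exact Finset.sum_eq_zero fun i hi => by
    rw [inner_gproj_basis he, if_neg (Finset.disjoint_left.1 hgg hi), zero_smul]

theorem gproj_gprojS (he : Orthonormal ℝ e) {G S : Finset (Finset ℕ)}
    (hG : (G : Set (Finset ℕ)).Pairwise fun g g' => Disjoint g g') (hS : S ⊆ G)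
    {g : Finset ℕ} (hg : g ∈ G) (x : H) :
    gproj e g (gprojS e S x) = if g ∈ S then gproj e g x else 0 := by
  rw [gprojS, gproj_sum]
  have : ∀ g' ∈ S, gproj e g (gproj e g' x) = if g = g' then gproj e g x else 0 := by
    intro g' hg'
    split_ifs with h
    · rw [← h, gproj_gproj_self he]
    · exact gproj_gproj_of_disjoint he (hG hg (hS hg') h) x
  rw [Finset.sum_congr rfl this, Finset.sum_ite_eq]

theorem gprojS_gprojS (he : Orthonormal ℝ e) {G S T : Finset (Finset ℕ)}
    (hG : (G : Set (Finset ℕ)).Pairwise fun g g' => Disjoint g g') (hS : S ⊆ T) (hT : T ⊆ G)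
    (x : H) : gprojS e T (gprojS e S x) = gprojS e S x := by
  rw [gprojS, Finset.sum_congr rfl fun g hg => gproj_gprojS he hG (hS.trans hT) (hT hg) x,
    Finset.sum_ite_mem, Finset.inter_eq_right.2 hS, gprojS]

theorem gprojS_mem_SigmaK (he : Orthonormal ℝ e) {G S : Finset (Finset ℕ)} {K : ℕ}
    (hG : (G : Set (Finset ℕ)).Pairwise fun g g' => Disjoint g g') (hS : S ⊆ G)
    (hSK : S.card ≤ K) (x : H) : gprojS e S x ∈ SigmaK e G K :=
  ⟨S, hS, hSK, (gprojS_gprojS he hG subset_rfl hS x).symm⟩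

theorem gprojS_eq_self_of_mem_Egrp (he : Orthonormal ℝ e) {G : Finset (Finset ℕ)}
    (hG : (G : Set (Finset ℕ)).Pairwise fun g g' => Disjoint g g') {x : H} (hx : x ∈ Egrp e G) :
    gprojS e G x = x := by
  refine Submodule.span_induction (p := fun x _ => gprojS e G x = x) ?_ ?_ ?_ ?_ hx
  · rintro _ ⟨i, hi, rfl⟩
    have : gprojS e G (e i) = ∑ j ∈ G.biUnion id, ⟪e i, e j⟫ • e j :=
      (Finset.sum_biUnion hG).symm
    rw [this, Finset.sum_eq_single_of_mem i (Finset.mem_coe.1 hi) fun j _ hji => by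
      rw [he.2 hji.symm, zero_smul], real_inner_self_eq_norm_sq, he.1 i, one_pow, one_smul]
  · simp [gprojS, gproj_zero]
  · intro x y _ _ hx hy
    rw [gprojS_add, hx, hy]
  · intro c x _ hx
    rw [gprojS_smul, hx]

theorem inner_gprojS (he : Orthonormal ℝ e) (S : Finset (Finset ℕ)) (u x : H) :
    ⟪u, gprojS e S x⟫ = ∑ g ∈ S, ⟪gproj e g u, gproj e g x⟫ := by
  rw [gprojS, inner_sum]
  refine Finset.sum_congr rfl fun g _ => ?_
  rw [gproj, inner_sum, inner_sum]
  exact Finset.sum_congr rfl fun i hi => by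
    rw [real_inner_smul_right, real_inner_smul_right, inner_gproj_basis he, if_pos hi]

theorem inner_gprojS_self (he : Orthonormal ℝ e) (S : Finset (Finset ℕ)) (x : H) :
    ⟪x, gprojS e S x⟫ = ∑ g ∈ S, ‖gproj e g x‖ ^ 2 := by
  simp [inner_gprojS he]

theorem norm_gprojS_sq (he : Orthonormal ℝ e) {G S : Finset (Finset ℕ)}
    (hG : (G : Set (Finset ℕ)).Pairwise fun g g' => Disjoint g g') (hS : S ⊆ G) (x : H) :
    ‖gprojS e S x‖ ^ 2 = ∑ g ∈ S, ‖gproj e g x‖ ^ 2 := by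
  rw [← real_inner_self_eq_norm_sq, inner_gprojS he]
  refine Finset.sum_congr rfl fun g hg => ?_
  rw [gproj_gprojS he hG hS (hS hg), if_pos hg, real_inner_self_eq_norm_sq]

theorem groupNormR_add_gprojS_sub (he : Orthonormal ℝ e) {G S : Finset (Finset ℕ)}
    (hG : (G : Set (Finset ℕ)).Pairwise fun g g' => Disjoint g g') (hS : S ⊆ G) (z : H) :
    groupNormR e G (gprojS e S (-z) + z) - groupNormR e G (gprojS e S (-z)) =
      ∑ g ∈ G, ‖gproj e g z‖ - 2 * ∑ g ∈ S, ‖gproj e g z‖ := by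
  rw [groupNormR, groupNormR, ← Finset.inter_eq_right.2 hS, ← Finset.sum_ite_mem, Finset.mul_sum,
    ← Finset.sum_sub_distrib, ← Finset.sum_sub_distrib, Finset.inter_eq_right.2 hS]
  refine Finset.sum_congr rfl fun g hg => ?_
  rw [gproj_add, gproj_gprojS he hG hS hg]
  split_ifs
  · simp only [gproj_neg, neg_add_cancel, norm_zero, norm_neg]
    ring
  · simp

end GroupProjections

theorem coneNorm_le_of_forall_inner_le [CompleteSpace H] {Γ : Set H}
    (hΓ : ∀ v ∈ Γ, ∀ c : ℝ, c • v ∈ Γ) {w : H} {t : ℝ} (ht : 0 < t) (hne : ∃ v ∈ Γ, v ≠ 0)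
    (h : ∀ (u : H) (M : ℝ), 0 ≤ M → (∀ v ∈ Γ, ⟪u, v⟫ ≤ M * ‖v‖) → ⟪u, w⟫ ≤ M * t) :
    coneNorm Γ w ≤ ENNReal.ofReal t := by
  suffices hw : w ∈ t • closure (convexHull ℝ (Γ ∩ sphere (0 : H) 1)) from
    iInf_le (fun s : {s : ℝ // 0 ≤ s ∧ w ∈ s • closure (convexHull ℝ (Γ ∩ sphere (0 : H) 1))} =>
      ENNReal.ofReal (s : ℝ)) ⟨t, ht.le, hw⟩
  by_contra hw
  obtain ⟨f, r, hfr, hrw⟩ := geometric_hahn_banach_closed_point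
    ((convex_convexHull ℝ (Γ ∩ sphere (0 : H) 1)).closure.smul t)
    (isClosed_closure.smul_of_ne_zero ht.ne') hw
  obtain ⟨u, rfl⟩ := (InnerProductSpace.toDual ℝ H).surjective f
  simp only [InnerProductSpace.toDual_apply_apply] at hfr hrw
  have hbound : ∀ v ∈ Γ, ⟪u, v⟫ ≤ r / t * ‖v‖ := by
    intro v hv
    rcases eq_or_ne v 0 with rfl | hv0
    · simp
    have hvpos : 0 < ‖v‖ := norm_pos_iff.2 hv0
    have := hfr (t • (‖v‖⁻¹ • v)) (Set.smul_mem_smul_set (subset_closure (subset_convexHull ℝ _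
      ⟨hΓ v hv _, by simp [norm_smul, hvpos.ne']⟩)))
    rw [real_inner_smul_right, real_inner_smul_right] at this
    rw [div_mul_eq_mul_div, le_div_iff₀ ht]
    calc ⟪u, v⟫ * t = (t * (‖v‖⁻¹ * ⟪u, v⟫)) * ‖v‖ := by field_simp
      _ ≤ r * ‖v‖ := mul_le_mul_of_nonneg_right this.le hvpos.le
  obtain ⟨v, hv, hv0⟩ := hne
  have hM : 0 ≤ r / t := by
    have h₁ := hbound v hv
    have h₂ := hbound _ (hΓ v hv (-1))
    simp only [neg_smul, one_smul, inner_neg_right, norm_neg] at h₂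
    exact nonneg_of_mul_nonneg_left (by linarith) (norm_pos_iff.2 hv0)
  have := h u (r / t) hM hbound
  rw [div_mul_cancel₀ _ ht.ne'] at this
  linarith

theorem stmt12 [CompleteSpace H]
    (e : ℕ → H) (he : Orthonormal ℝ e)
    (htot : (Submodule.span ℝ (Set.range e)).topologicalClosure = ⊤)
    (G : Finset (Finset ℕ)) (hGne : ∀ g ∈ G, g.Nonempty)
    (hGdisj : (G : Set (Finset ℕ)).Pairwise fun g g' => Disjoint g g')
    (K : ℕ) (hK1 : 1 ≤ K) (hKG : K ≤ G.card)
    (z : H) (hz0 : z ≠ 0)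
    (hdesc : ∃ x ∈ SigmaK e G K, groupNorm e G (x + z) ≤ groupNorm e G x)
    (x : H) (hx : x ∈ SigmaK e G K)
    (hmin : ∀ y ∈ SigmaK e G K,
      groupNormR e G (x + z) - groupNormR e G x ≤
      groupNormR e G (y + z) - groupNormR e G y) :
    x ≠ 0 ∧ coneNorm (SigmaK e G K) (x + z) ≤ ENNReal.ofReal ‖x‖ := by
  obtain ⟨y, hy, hyz⟩ := hdesc
  have hSigmaE : ∀ v ∈ SigmaK e G K, v ∈ Egrp e G := by
    rintro v ⟨S, hSG, -, hvS⟩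
    rw [hvS]
    exact gprojS_mem_Egrp e hSG v
  have hyE := hSigmaE y hy
  have hyzE : y + z ∈ Egrp e G := by
    by_contra hc
    simp [groupNorm, hc, hyE] at hyz
  have hzE : z ∈ Egrp e G := by
    have := Submodule.sub_mem _ hyzE hyE
    rwa [add_sub_cancel_left] at this
  have hdescR : groupNormR e G (y + z) ≤ groupNormR e G y := by
    rw [groupNorm, groupNorm, if_pos hyzE, if_pos hyE] at hyz
    exact (ENNReal.ofReal_le_ofReal_iff (Finset.sum_nonneg fun _ _ => norm_nonneg _)).1 hyz
  have hle : ∀ S ⊆ G, S.card ≤ K → groupNormR e G (x + z) - groupNormR e G x ≤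
      ∑ g ∈ G, ‖gproj e g z‖ - 2 * ∑ g ∈ S, ‖gproj e g z‖ := fun S hS hSK => by
    rw [← groupNormR_add_gprojS_sub he hGdisj hS]
    exact hmin _ (gprojS_mem_SigmaK he hGdisj hS hSK _)
  have hx0 : x ≠ 0 := by
    rintro rfl
    refine hz0 ?_
    rw [← gprojS_eq_self_of_mem_Egrp he hGdisj hzE]
    refine Finset.sum_eq_zero fun g hg => ?_
    have := hle {g} (by simpa using hg) (by simpa using hK1)
    simp only [groupNormR, zero_add, gproj_zero, norm_zero, Finset.sum_const_zero,
      Finset.sum_singleton] at this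
    exact norm_le_zero_iff.1 (by linarith)
  refine ⟨hx0, ?_⟩
  have hxE := hSigmaE x hx
  have hwE : x + z ∈ Egrp e G := Submodule.add_mem _ hxE hzE
  obtain ⟨S, hSG, hSK, hxS⟩ := id hx
  obtain ⟨T, hST, hTG, hTK⟩ := Finset.exists_subsuperset_card_eq hSG hSK hKG
  have hxT : gprojS e T x = x := by
    rw [hxS]
    exact gprojS_gprojS he hGdisj hST hTG x
  have hx_off : ∀ g ∈ G, g ∉ T → gproj e g x = 0 := fun g hg hgT => by
    rw [← hxT, gproj_gprojS he hGdisj hTG hg, if_neg hgT]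
  have hsplit : ∀ f : Finset ℕ → ℝ, ∑ g ∈ G, f g = ∑ g ∈ G \ T, f g + ∑ g ∈ T, f g :=
    fun f => (Finset.sum_sdiff hTG).symm
  have hval : groupNormR e G (x + z) - groupNormR e G x =
      ∑ g ∈ G \ T, ‖gproj e g z‖ + ∑ g ∈ T, (‖gproj e g (x + z)‖ - ‖gproj e g x‖) := by
    rw [groupNormR, groupNormR, ← Finset.sum_sub_distrib, hsplit]
    congr 1
    refine Finset.sum_congr rfl fun g hg => ?_
    rw [Finset.mem_sdiff] at hg
    simp [gproj_add, hx_off g hg.1 hg.2]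
  have htri : ∀ g ∈ T, ‖gproj e g x‖ ≤ ‖gproj e g (x + z)‖ + ‖gproj e g z‖ := fun g _ => by
    rw [gproj_add]
    exact norm_le_add_norm_add _ _
  have hnorm : ∀ g ∈ T, ‖gproj e g x‖ = ‖gproj e g (x + z)‖ + ‖gproj e g z‖ := by
    refine (Finset.sum_eq_sum_iff_of_le htri).1 (le_antisymm (Finset.sum_le_sum htri) ?_)
    have h₁ := hle T hTG hTK.le
    rw [hval, hsplit, Finset.sum_sub_distrib] at h₁
    rw [Finset.sum_add_distrib]
    linarith
  have hval' : groupNormR e G (x + z) - groupNormR e G x =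
      ∑ g ∈ G, ‖gproj e g z‖ - 2 * ∑ g ∈ T, ‖gproj e g z‖ := by
    rw [hval, hsplit, Finset.sum_sub_distrib, Finset.sum_congr rfl hnorm, Finset.sum_add_distrib]
    ring
  have hsum : ∑ g ∈ G \ T, ‖gproj e g z‖ ≤ ∑ g ∈ T, ‖gproj e g z‖ := by
    have := hmin y hy
    rw [hval', hsplit] at this
    linarith
  have hsep : ∀ g ∈ T, ∀ h ∈ G, h ∉ T → ‖gproj e h z‖ ≤ ‖gproj e g z‖ := by
    intro g hg h hh hhT
    have hh' : h ∉ T.erase g := fun hc => hhT (Finset.mem_of_mem_erase hc)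
    have := hle (insert h (T.erase g))
      (Finset.insert_subset hh ((Finset.erase_subset _ _).trans hTG)) (by
        rw [Finset.card_insert_of_notMem hh', Finset.card_erase_of_mem hg]
        omega)
    rw [hval', Finset.sum_insert hh', ← Finset.add_sum_erase T _ hg] at this
    linarith
  refine coneNorm_le_of_forall_inner_le (fun v hv c => smul_mem_SigmaK e hv c)
    (norm_pos_iff.2 hx0) ⟨x, hx, hx0⟩ fun u M hM hu => ?_
  have hxnorm : ‖x‖ = √(∑ g ∈ T, (‖gproj e g (x + z)‖ + ‖gproj e g z‖) ^ 2) := by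
    rw [← Finset.sum_congr rfl fun g hg => congrArg (· ^ 2) (hnorm g hg),
      ← norm_gprojS_sq he hGdisj hTG, hxT, Real.sqrt_sq (norm_nonneg _)]
  have huM : ∀ S ⊆ G, S.card = T.card → ∑ g ∈ S, ‖gproj e g u‖ ^ 2 ≤ M ^ 2 := by
    intro S hSG hST
    have := hu _ (gprojS_mem_SigmaK he hGdisj hSG (hST.trans hTK).le u)
    rw [inner_gprojS_self he, ← norm_gprojS_sq he hGdisj hSG] at this
    rw [← norm_gprojS_sq he hGdisj hSG]
    refine pow_le_pow_left₀ (norm_nonneg _) ?_ 2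
    rcases (norm_nonneg (gprojS e S u)).eq_or_lt with h | h
    · rwa [← h]
    · exact le_of_mul_le_mul_right (by rwa [← sq]) h
  calc ⟪u, x + z⟫ = ∑ g ∈ G, ⟪gproj e g u, gproj e g (x + z)⟫ := by
        rw [← inner_gprojS he, gprojS_eq_self_of_mem_Egrp he hGdisj hwE]
    _ ≤ ∑ g ∈ G, ‖gproj e g (x + z)‖ * ‖gproj e g u‖ :=
        Finset.sum_le_sum fun g _ => (real_inner_le_norm _ _).trans_eq (mul_comm _ _)
    _ = ∑ g ∈ T, ‖gproj e g (x + z)‖ * ‖gproj e g u‖ +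
          ∑ g ∈ G \ T, ‖gproj e g z‖ * ‖gproj e g u‖ := by
        rw [hsplit, add_comm]
        congr 1
        refine Finset.sum_congr rfl fun g hg => ?_
        rw [Finset.mem_sdiff] at hg
        rw [gproj_add, hx_off g hg.1 hg.2, zero_add]
    _ ≤ M * ‖x‖ := by
        rw [hxnorm]
        exact sum_mul_add_sum_sdiff_mul_le hTG
          (Finset.card_pos.1 (by omega)) (fun _ => norm_nonneg _) (fun _ => norm_nonneg _)
          (fun _ => norm_nonneg _) hsep hsum hM huM
end
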